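/- Let G be a nonzero n×n real symmetric positive semi-definite matrix (possibly singular) with largest eigenvalue λ_max. Let α > 0 be a non-integer real with α ≠ 1, let ε ∈ (0,1/3), δ ∈ (0,1), set s = ⌈8·ln(2/δ)/ε²⌉, and let m be an integer with m ≥ α + (n·Γ(α+1/2)·Γ(α)/(ε·π^{3/2}))^{1/(2α)}. Let g₁,…,g_s be i.i.d. standard Gaussian vectors in ℝⁿ and define the Chebyshev estimator S̃_α(G) = (1/(1−α))·log₂((1/s)·Σ_{i=1}^s gᵢᵀ f_m(G) gᵢ), where f_m(G) = (c₀/2)·I + Σ_{k=1}^m c_k·T_k(2G/λ_max − I). Then with probability at least 1−δ one has |S_α(G) − S̃_α(G)| ≤ |(1/(1−α))·log₂(1−3ε)|. -/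

import Mathlib

open MeasureTheory ProbabilityTheory Matrix

/-- Joint law of `s` i.i.d. standard Gaussian vectors in `ℝⁿ`
(each vector has `n` i.i.d. standard normal coordinates). -/
noncomputable def gaussianVecs (s n : ℕ) : Measure (Fin s → Fin n → ℝ) :=
  Measure.pi fun _ => Measure.pi fun _ => gaussianReal 0 1

/-- Chebyshev coefficients of `x^α` on `[0, λ_max]`:
`c_k = 2·λ_max^α·Γ(α+1/2)·Γ(α+1)/(√π·Γ(α−k+1)·Γ(α+k+1))`. -/
noncomputable def chebCoeff (α lmax : ℝ) (k : ℕ) : ℝ :=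
  2 * lmax ^ α * Real.Gamma (α + 1 / 2) * Real.Gamma (α + 1) /
    (Real.sqrt Real.pi * Real.Gamma (α - k + 1) * Real.Gamma (α + k + 1))

/-- Degree-`m` Chebyshev approximant of the matrix power `G^α` on `[0, λ_max]`:
`f_m(G) = (c₀/2)·I + Σ_{k=1}^m c_k·T_k(2G/λ_max − I)`. -/
noncomputable def chebApproxMatrix {n : ℕ} (α lmax : ℝ) (m : ℕ)
    (G : Matrix (Fin n) (Fin n) ℝ) : Matrix (Fin n) (Fin n) ℝ :=
  (chebCoeff α lmax 0 / 2) • (1 : Matrix (Fin n) (Fin n) ℝ) +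
    ∑ k ∈ Finset.Icc 1 m, chebCoeff α lmax k •
      Polynomial.aeval ((2 / lmax) • G - 1) (Polynomial.Chebyshev.T ℝ (k : ℤ))

theorem integral_one_add_cos_div_two_rpow {α : ℝ} (hα : 0 < α) :
    ∫ θ in (0 : ℝ)..Real.pi, ((1 + Real.cos θ) / 2) ^ α =
      Real.sqrt Real.pi * Real.Gamma (α + 1 / 2) / Real.Gamma (α + 1) := by
  have h := Polynomial.Chebyshev.integral_measureT_eq_integral_cos (f := fun x => ((1 + x) / 2) ^ α)
  rw [← h, Polynomial.Chebyshev.integral_measureT]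
  have hsub := intervalIntegral.integral_comp_mul_sub (a := 0) (b := 1)
    (fun x : ℝ => ((1 + x) / 2) ^ α * √(1 - x ^ 2)⁻¹) (two_ne_zero) (1 : ℝ)
  norm_num at hsub
  have h2 : ∫ x in (-1 : ℝ)..1, ((1 + x) / 2) ^ α * √(1 - x ^ 2)⁻¹ =
      2 * ∫ x in (0 : ℝ)..1, ((1 + (2 * x - 1)) / 2) ^ α * √(1 - (2 * x - 1) ^ 2)⁻¹ := by
    simp only [Real.sqrt_inv]
    norm_num
    linarith
  rw [h2]
  have hb := beta_eq_betaIntegralReal (α + 1 / 2) (1 / 2) (by linarith) (by norm_num)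
  rw [beta, Real.Gamma_one_half_eq, show α + 1 / 2 + 1 / 2 = α + 1 by ring] at hb
  rw [mul_comm (√Real.pi), hb, Complex.betaIntegral, ← intervalIntegral.integral_const_mul]
  have hc : ∫ x in (0 : ℝ)..1, (x : ℂ) ^ (((α + 1 / 2 : ℝ) : ℂ) - 1) *
      (1 - (x : ℂ)) ^ (((1 / 2 : ℝ) : ℂ) - 1) =
      ∫ x in (0 : ℝ)..1, ((x ^ (α - 1 / 2) * (1 - x) ^ (-(1 / 2) : ℝ) : ℝ) : ℂ) := by
    refine intervalIntegral.integral_congr fun x hx => ?_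
    rw [Set.uIcc_of_le zero_le_one] at hx
    rw [Complex.ofReal_mul, Complex.ofReal_cpow hx.1, Complex.ofReal_cpow (sub_nonneg.2 hx.2)]
    push_cast
    congr 2 <;> ring
  rw [hc, intervalIntegral.integral_ofReal, Complex.ofReal_re]
  refine intervalIntegral.integral_congr_ae ?_
  have h1 : ∀ᵐ x : ℝ, x ≠ 1 := by simp [ae_iff]
  filter_upwards [h1] with x hx1 hx
  rw [Set.uIoc_of_le zero_le_one] at hx
  have hx0 : 0 < x := hx.1
  have hx1' : 0 < 1 - x := sub_pos.2 (lt_of_le_of_ne hx.2 hx1)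
  rw [show (1 + (2 * x - 1)) / 2 = x by ring,
    show 1 - (2 * x - 1) ^ 2 = (2 : ℝ) ^ 2 * (x * (1 - x)) by ring, Real.sqrt_inv,
    Real.sqrt_mul (by norm_num), Real.sqrt_sq (by norm_num), Real.sqrt_mul hx0.le,
    Real.rpow_sub hx0, Real.rpow_neg hx1'.le, Real.sqrt_eq_rpow, Real.sqrt_eq_rpow]
  have := Real.rpow_pos_of_pos hx0 (1/2)
  have := Real.rpow_pos_of_pos hx1' (1/2)
  field_simp

/-- The Fourier coefficients of `θ ↦ ((1 + cos θ) / 2) ^ α`. -/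
noncomputable def cosRpowCoeff (α : ℝ) (n : ℤ) : ℝ :=
  Real.Gamma (α + 1 / 2) * Real.Gamma (α + 1) /
    (Real.sqrt Real.pi * Real.Gamma (α - n + 1) * Real.Gamma (α + n + 1))

theorem cosRpowCoeff_neg (α : ℝ) (n : ℤ) : cosRpowCoeff α (-n) = cosRpowCoeff α n := by
  simp only [cosRpowCoeff]
  push_cast
  rw [sub_neg_eq_add, ← sub_eq_add_neg]
  ring

theorem ne_intCast_of_forall_ne_natCast {α : ℝ} (hα : 0 < α) (h : ∀ k : ℕ, α ≠ k) (n : ℤ) :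
    α ≠ n := by
  rintro rfl
  have : 0 ≤ n := by exact_mod_cast hα.le
  lift n to ℕ using this
  exact h n (by simp)

theorem Gamma_add_intCast_ne_zero {α : ℝ} (h : ∀ n : ℤ, α ≠ n) (n : ℤ) :
    Real.Gamma (α + n) ≠ 0 := by
  refine Real.Gamma_ne_zero fun m hm => h (-m - n) ?_
  push_cast
  linarith

theorem cosRpowCoeff_succ {α : ℝ} (h : ∀ n : ℤ, α ≠ n) (n : ℤ) :
    (α + n + 1) * cosRpowCoeff α (n + 1) = (α - n) * cosRpowCoeff α n := by
  have h1 : Real.Gamma (α - n) ≠ 0 := by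
    simpa [sub_eq_add_neg] using Gamma_add_intCast_ne_zero h (-n)
  have h2 : Real.Gamma (α + n + 1) ≠ 0 := by
    simpa [add_assoc] using Gamma_add_intCast_ne_zero h (n + 1)
  have h3 : α - n ≠ 0 := sub_ne_zero.2 (h n)
  have h4 : α + n + 1 ≠ 0 := fun h0 => h (-n - 1) (by push_cast; linarith)
  simp only [cosRpowCoeff]
  push_cast
  rw [show α - (n + 1) + 1 = α - n by ring, show α + (n + 1) + 1 = (α + n + 1) + 1 by ring,
    Real.Gamma_add_one h3, Real.Gamma_add_one h4]
  have := Real.sqrt_pos.2 Real.pi_pos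
  field_simp

theorem integral_exp_mul_one_add_cos_rpow_succ {α : ℝ} (hα : 0 < α) (n : ℤ) :
    ((α : ℂ) + n + 1) * ∫ θ in (-Real.pi)..Real.pi,
      Complex.exp (-(n + 1) * (θ * Complex.I)) * ((((1 + Real.cos θ) / 2) ^ α : ℝ) : ℂ) =
    ((α : ℂ) - n) * ∫ θ in (-Real.pi)..Real.pi,
      Complex.exp (-n * (θ * Complex.I)) * ((((1 + Real.cos θ) / 2) ^ α : ℝ) : ℂ) := by
  have hF : Continuous fun θ : ℝ => ((((1 + Real.cos θ) / 2) ^ α : ℝ) : ℂ) :=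
    Complex.continuous_ofReal.comp
      (((continuous_const.add Real.continuous_cos).div_const 2).rpow_const fun _ => Or.inr hα.le)
  have hE (z : ℂ) : Continuous fun θ : ℝ => Complex.exp (z * (θ * Complex.I)) := by fun_prop
  have key := intervalIntegral.integral_eq_sub_of_hasDerivAt_of_le
    (a := -Real.pi) (b := Real.pi) (by linarith [Real.pi_pos])
    (f := fun θ : ℝ => ((((1 + Real.cos θ) / 2) ^ α : ℝ) : ℂ) *
      (Complex.exp (-(n + 1) * (θ * Complex.I)) + Complex.exp (-n * (θ * Complex.I))))
    (f' := fun θ : ℝ => Complex.I * ((α - n) *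
      (Complex.exp (-n * (θ * Complex.I)) * ((((1 + Real.cos θ) / 2) ^ α : ℝ) : ℂ)) - (α + n + 1) *
      (Complex.exp (-(n + 1) * (θ * Complex.I)) * ((((1 + Real.cos θ) / 2) ^ α : ℝ) : ℂ))))
    ((hF.mul ((hE _).add (hE _))).continuousOn) ?_ ?_
  · rw [intervalIntegral.integral_const_mul, intervalIntegral.integral_sub,
      intervalIntegral.integral_const_mul, intervalIntegral.integral_const_mul] at key
    · simp [Real.zero_rpow hα.ne'] at key
      simpa using (sub_eq_zero.1 key).symm
    · exact ((continuous_const.mul ((hE _).mul hF))).intervalIntegrable _ _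
    · exact ((continuous_const.mul ((hE _).mul hF))).intervalIntegrable _ _
  · intro θ hθ
    have hpos : 0 < 1 + Real.cos θ := by
      have h1 : 0 < Real.cos (θ / 2) :=
        Real.cos_pos_of_mem_Ioo ⟨by linarith [hθ.1], by linarith [hθ.2]⟩
      have h2 := Real.cos_sq (θ / 2)
      rw [mul_div_cancel₀ _ (two_ne_zero)] at h2
      nlinarith
    have hd1 : HasDerivAt (fun θ : ℝ => ((1 + Real.cos θ) / 2) ^ α)
        (-(Real.sin θ) / 2 * α * ((1 + Real.cos θ) / 2) ^ (α - 1)) θ :=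
      (((Real.hasDerivAt_cos θ).const_add 1).div_const 2).rpow_const (Or.inl (by positivity))
    have hd2 (z : ℂ) : HasDerivAt (fun θ : ℝ => Complex.exp (z * (θ * Complex.I)))
        (Complex.exp (z * (θ * Complex.I)) * (z * (1 * Complex.I))) θ :=
      (((Complex.ofRealCLM.hasDerivAt (x := θ)).mul_const Complex.I).const_mul z).cexp
    have hd := hd1.ofReal_comp.mul ((hd2 (-(n + 1))).add (hd2 (-n)))
    refine hd.congr_deriv ?_
    have hexp : Complex.exp (-n * (θ * Complex.I)) =
        Complex.exp (-(n + 1) * (θ * Complex.I)) * Complex.exp (θ * Complex.I) := by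
      rw [← Complex.exp_add]; ring_nf
    have hne : ((1 + Real.cos θ : ℝ) : ℂ) ≠ 0 := by exact_mod_cast hpos.ne'
    rw [Real.rpow_sub_one (by positivity)]
    have htrig : (Real.sin θ : ℂ) * (1 + Complex.exp (θ * Complex.I)) =
        -Complex.I * (Complex.exp (θ * Complex.I) - 1) * ((1 + Real.cos θ : ℝ) : ℂ) := by
      rw [Complex.exp_mul_I]
      push_cast
      have hsc := Complex.sin_sq_add_cos_sq (θ : ℂ)
      linear_combination (Complex.I) * hsc + (Complex.sin θ * (1 + Complex.cos θ)) * Complex.I_sq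
    simp only [Pi.add_apply]
    rw [hexp]
    push_cast at hne htrig ⊢
    field_simp
    generalize (((1 + Real.cos θ) / 2) ^ α : ℝ) = F at *
    generalize Complex.exp (θ * Complex.I) = e at *
    generalize Complex.exp (-((n + 1) * (θ * Complex.I))) = e1 at *
    linear_combination (-(F * α) : ℂ) * htrig
  · exact (continuous_const.mul ((continuous_const.mul ((hE _).mul hF)).sub
      (continuous_const.mul ((hE _).mul hF)))).intervalIntegrable _ _

theorem integral_exp_mul_one_add_cos_rpow {α : ℝ} (hα : 0 < α) (h : ∀ n : ℤ, α ≠ n) (n : ℤ) :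
    ∫ θ in (-Real.pi)..Real.pi,
      Complex.exp (-n * (θ * Complex.I)) * ((((1 + Real.cos θ) / 2) ^ α : ℝ) : ℂ) =
    ((2 * Real.pi * cosRpowCoeff α n : ℝ) : ℂ) := by
  induction n with
  | zero =>
    have hcont : Continuous fun θ : ℝ => ((1 + Real.cos θ) / 2) ^ α :=
      ((continuous_const.add Real.continuous_cos).div_const 2).rpow_const fun _ => Or.inr hα.le
    have hhalf : ∫ θ in (-Real.pi)..0, ((1 + Real.cos θ) / 2) ^ α =
        ∫ θ in (0 : ℝ)..Real.pi, ((1 + Real.cos θ) / 2) ^ α := by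
      have := intervalIntegral.integral_comp_neg (a := -Real.pi) (b := 0)
        fun θ => ((1 + Real.cos θ) / 2) ^ α
      simpa using this
    have hG := Real.Gamma_pos_of_pos (show 0 < α + 1 by linarith)
    have hsq := Real.mul_self_sqrt Real.pi_pos.le
    have hs := Real.sqrt_pos.2 Real.pi_pos
    simp only [Int.cast_zero, neg_zero, zero_mul, Complex.exp_zero, one_mul]
    rw [intervalIntegral.integral_ofReal, ← intervalIntegral.integral_add_adjacent_intervals
      (hcont.intervalIntegrable _ 0) (hcont.intervalIntegrable _ _), hhalf,
      integral_one_add_cos_div_two_rpow hα, cosRpowCoeff]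
    congr 1
    simp only [Int.cast_zero, sub_zero, add_zero]
    field_simp
    linear_combination 2 * hsq
  | succ i ih =>
    have h1 := integral_exp_mul_one_add_cos_rpow_succ hα (i : ℤ)
    have h2 : (α : ℂ) + (i : ℤ) + 1 ≠ 0 := by
      intro h0
      exact h (-(i : ℤ) - 1) (by push_cast; exact_mod_cast (by linear_combination h0 :
        (α : ℂ) = -(i : ℂ) - 1))
    have h3 := cosRpowCoeff_succ h (i : ℤ)
    have h3' := congrArg (fun x : ℝ => (x : ℂ)) h3
    rw [ih] at h1
    refine mul_left_cancel₀ h2 ?_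
    push_cast at h1 h3' ⊢
    rw [h1]
    linear_combination -2 * (Real.pi : ℂ) * h3'
  | pred i ih =>
    have h1 := integral_exp_mul_one_add_cos_rpow_succ hα (-(i : ℤ) - 1)
    have h2 : (α : ℂ) - (-(i : ℤ) - 1 : ℤ) ≠ 0 := by
      intro h0
      exact h (-(i : ℤ) - 1) (by exact_mod_cast sub_eq_zero.1 h0)
    have h3 := cosRpowCoeff_succ h (-(i : ℤ) - 1)
    rw [sub_add_cancel] at h3
    have h3' := congrArg (fun x : ℝ => (x : ℂ)) h3
    have hz : -((-(i : ℤ) - 1 : ℤ) + 1 : ℂ) = -((-(i : ℤ) : ℤ) : ℂ) := by push_cast; ring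
    rw [hz, ih] at h1
    refine mul_left_cancel₀ h2 ?_
    rw [← h1]
    push_cast at h3' ⊢
    linear_combination 2 * (Real.pi : ℂ) * h3'

theorem two_mul_sum_abs_cosRpowCoeff {α : ℝ} (hα : 0 < α) (h : ∀ n : ℤ, α ≠ n) {M : ℕ}
    (hM : α ≤ M) (N : ℕ) :
    2 * α * ∑ k ∈ Finset.range N, |cosRpowCoeff α ((k + M : ℕ) : ℤ)| +
      (α + (N + M : ℕ)) * |cosRpowCoeff α ((N + M : ℕ) : ℤ)| = (α + M) * |cosRpowCoeff α M| := by
  induction N with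
  | zero => simp
  | succ N ih =>
    rw [← ih, Finset.sum_range_succ, show N + 1 + M = (N + M) + 1 by ring]
    have h1 := congrArg abs (cosRpowCoeff_succ h ((N + M : ℕ) : ℤ))
    have hle : α ≤ ((N + M : ℕ) : ℝ) := by push_cast; linarith [(Nat.cast_nonneg N : (0 : ℝ) ≤ N)]
    rw [abs_mul, abs_mul, Int.cast_natCast, abs_of_pos (show 0 < α + ((N + M : ℕ) : ℝ) + 1 by positivity),
      abs_of_nonpos (sub_nonpos.2 hle)] at h1
    rw [Nat.cast_succ, Nat.cast_succ]
    linear_combination h1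

theorem rpow_mul_Gamma_le_Gamma_add {x β : ℝ} (hx : 1 < x) (hβ : 0 < β) :
    (x - 1) ^ β * Real.Gamma x ≤ Real.Gamma (x + β) := by
  have h0 : 0 < x - 1 := by linarith
  have hG0 := Real.Gamma_pos_of_pos h0
  have hG1 := Real.Gamma_pos_of_pos (show 0 < x by linarith)
  have hG2 := Real.Gamma_pos_of_pos (show 0 < x + β by linarith)
  have hslope := Real.convexOn_log_Gamma.slope_mono_adjacent (x := x - 1) (y := x) (z := x + β)
    h0 (show (0 : ℝ) < x + β by linarith) (by linarith) (by linarith)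
  have hstep : Real.Gamma x = (x - 1) * Real.Gamma (x - 1) := by
    rw [← Real.Gamma_add_one h0.ne', sub_add_cancel]
  simp only [Function.comp_apply, sub_sub_cancel, div_one, add_sub_cancel_left] at hslope
  rw [le_div_iff₀ hβ] at hslope
  have hlog : Real.log (Real.Gamma x) - Real.log (Real.Gamma (x - 1)) = Real.log (x - 1) := by
    rw [hstep, Real.log_mul h0.ne' hG0.ne']; ring
  rw [hlog] at hslope
  rw [← Real.log_le_log_iff (by positivity) hG2, Real.log_mul (by positivity) hG1.ne',
    Real.log_rpow h0]
  linarith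

theorem mul_abs_cosRpowCoeff_le {α : ℝ} (hα : 0 < α) (h : ∀ n : ℤ, α ≠ n) {m : ℕ} (hm : α < m) :
    (α + (m + 1 : ℕ)) * |cosRpowCoeff α (m + 1 : ℕ)| ≤
      Real.Gamma (α + 1 / 2) * Real.Gamma (α + 1) /
        (Real.pi ^ (3 / 2 : ℝ) * (m - α) ^ (2 * α)) := by
  have hm0 : 0 < (m : ℝ) - α := sub_pos.2 hm
  have hGh := Real.Gamma_pos_of_pos (show 0 < α + 1 / 2 by linarith)
  have hG1 := Real.Gamma_pos_of_pos (show 0 < α + 1 by linarith)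
  have hGp := Real.Gamma_pos_of_pos (show 0 < α + m + 1 by positivity)
  have hGr := Real.Gamma_pos_of_pos (show 0 < (m : ℝ) - α + 1 by linarith)
  have hGn : Real.Gamma (α - m) ≠ 0 := by
    simpa [sub_eq_add_neg] using Gamma_add_intCast_ne_zero h (-m)
  have hs := Real.sqrt_pos.2 Real.pi_pos
  have hpi : Real.pi ^ (3 / 2 : ℝ) = Real.pi * √Real.pi := by
    rw [show (3 / 2 : ℝ) = 1 + 1 / 2 by norm_num, Real.rpow_add Real.pi_pos, Real.rpow_one,
      Real.sqrt_eq_rpow]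
  have hrefl := Real.Gamma_mul_Gamma_one_sub (α - m)
  rw [show 1 - (α - m) = m - α + 1 by ring] at hrefl
  have hne : Real.sin (Real.pi * (α - m)) ≠ 0 := by
    intro h0
    rw [h0, div_zero] at hrefl
    exact mul_ne_zero hGn hGr.ne' hrefl
  have hinv : |Real.Gamma (α - m)|⁻¹ ≤ Real.Gamma (m - α + 1) / Real.pi := by
    rw [eq_div_iff hne] at hrefl
    have h1 := congrArg abs hrefl
    rw [abs_mul, abs_mul, abs_of_pos hGr, abs_of_pos Real.pi_pos] at h1
    have h2 := Real.abs_sin_le_one (Real.pi * (α - m))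
    have h3 := abs_pos.2 hGn
    rw [inv_le_comm₀ h3 (by positivity), inv_div, div_le_iff₀ hGr, ← h1]
    exact mul_le_of_le_one_right (by positivity) h2
  have hconv := rpow_mul_Gamma_le_Gamma_add (x := m - α + 1) (β := 2 * α) (by linarith)
    (by linarith)
  rw [show (m : ℝ) - α + 1 + 2 * α = α + m + 1 by ring, add_sub_cancel_right] at hconv
  have hcoef : (α + (m + 1 : ℕ)) * |cosRpowCoeff α (m + 1 : ℕ)| =
      Real.Gamma (α + 1 / 2) * Real.Gamma (α + 1) / (√Real.pi * Real.Gamma (α + m + 1)) *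
        |Real.Gamma (α - m)|⁻¹ := by
    have h4 : (0 : ℝ) < α + (m + 1) := by positivity
    rw [cosRpowCoeff, abs_div, abs_mul, abs_mul, abs_mul, abs_of_pos hGh, abs_of_pos hG1,
      abs_of_pos hs]
    push_cast
    rw [show α - (m + 1) + 1 = α - m by ring, Real.Gamma_add_one h4.ne', ← add_assoc,
      abs_of_pos (show 0 < (α + m + 1) * Real.Gamma (α + m + 1) by positivity)]
    have h3 := abs_pos.2 hGn
    field_simp
  have hp : 0 < ((m : ℝ) - α) ^ (2 * α) := by positivity
  rw [hcoef, hpi]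
  calc _ ≤ Real.Gamma (α + 1 / 2) * Real.Gamma (α + 1) / (√Real.pi * Real.Gamma (α + m + 1)) *
        (Real.Gamma (m - α + 1) / Real.pi) := by gcongr
    _ ≤ _ := by
      rw [div_mul_div_comm, div_le_div_iff₀ (by positivity) (by positivity)]
      have : 0 ≤ Real.Gamma (α + 1 / 2) * Real.Gamma (α + 1) * Real.pi * √Real.pi := by positivity
      nlinarith [mul_le_mul_of_nonneg_left hconv this]

theorem summable_cosRpowCoeff {α : ℝ} (hα : 0 < α) (h : ∀ n : ℤ, α ≠ n) :
    Summable (cosRpowCoeff α) := by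
  obtain ⟨M, hM⟩ := exists_nat_ge α
  have hnat : Summable fun k : ℕ => cosRpowCoeff α k := by
    rw [← summable_nat_add_iff M]
    refine Summable.of_abs (summable_of_sum_range_le (c := (α + M) * |cosRpowCoeff α M| / (2 * α))
      (fun _ => abs_nonneg _) fun N => ?_)
    rw [le_div_iff₀ (by positivity), ← two_mul_sum_abs_cosRpowCoeff hα h hM N]
    have : 0 ≤ (α + (N + M : ℕ)) * |cosRpowCoeff α ((N + M : ℕ) : ℤ)| := by positivity
    linarith
  exact Summable.of_nat_of_neg hnat (by simpa only [cosRpowCoeff_neg] using hnat)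

theorem hasSum_cosRpowCoeff_mul_cos {α : ℝ} (hα : 0 < α) (h : ∀ n : ℤ, α ≠ n) (θ : ℝ) :
    HasSum (fun k : ℕ => 2 * cosRpowCoeff α k * Real.cos (k * θ))
      (((1 + Real.cos θ) / 2) ^ α + cosRpowCoeff α 0) := by
  have : Fact (0 < 2 * Real.pi) := ⟨Real.two_pi_pos⟩
  have hcont : Continuous fun θ : ℝ => ((((1 + Real.cos θ) / 2) ^ α : ℝ) : ℂ) :=
    Complex.continuous_ofReal.comp
      (((continuous_const.add Real.continuous_cos).div_const 2).rpow_const fun _ => Or.inr hα.le)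
  have hper : Function.Periodic (fun θ : ℝ => ((((1 + Real.cos θ) / 2) ^ α : ℝ) : ℂ))
      (2 * Real.pi) := fun θ => by simp
  let F : C(AddCircle (2 * Real.pi), ℂ) := ⟨hper.lift, continuous_coinduced_dom.2 hcont⟩
  have hcoeff (n : ℤ) : fourierCoeff F n = cosRpowCoeff α n := by
    rw [fourierCoeff_eq_intervalIntegral _ _ (-Real.pi),
      show -Real.pi + 2 * Real.pi = Real.pi by ring]
    have hi : ∫ θ in (-Real.pi)..Real.pi, (fourier (-n) (θ : AddCircle (2 * Real.pi)) : ℂ) • F θ =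
        ∫ θ in (-Real.pi)..Real.pi,
      Complex.exp (-n * (θ * Complex.I)) * ((((1 + Real.cos θ) / 2) ^ α : ℝ) : ℂ) := by
      refine intervalIntegral.integral_congr fun x _ => ?_
      simp only [fourier_coe_apply, smul_eq_mul]
      congr 2
      push_cast
      field_simp
    rw [hi, integral_exp_mul_one_add_cos_rpow hα h]
    have := Real.pi_ne_zero
    rw [Complex.real_smul, ← Complex.ofReal_mul]
    congr 1
    field_simp
  have hsum : Summable (fourierCoeff F) := by
    rw [funext hcoeff]
    exact (Complex.hasSum_ofReal.2 (summable_cosRpowCoeff hα h).hasSum).summable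
  have hF := (has_pointwise_sum_fourier_series_of_summable hsum (θ : AddCircle (2 * Real.pi)))
  have hF' := Complex.hasSum_re hF.nat_add_neg
  convert! hF' using 1
  · ext k
    simp only [hcoeff, fourier_coe_apply, cosRpowCoeff_neg, smul_eq_mul, Complex.add_re,
      Complex.re_ofReal_mul]
    have hk (z : ℝ) : Complex.exp (2 * Real.pi * Complex.I * z * θ / (2 * Real.pi : ℝ)) =
        Complex.exp ((z * θ : ℝ) * Complex.I) := by
      congr 1
      push_cast
      have : (Real.pi : ℂ) ≠ 0 := by exact_mod_cast Real.pi_ne_zero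
      field_simp
    have h1 := hk k
    have h2 := hk (-k)
    push_cast at h1 h2 ⊢
    rw [h1, h2]
    have e1 := Complex.exp_ofReal_mul_I_re (k * θ)
    have e2 := Complex.exp_ofReal_mul_I_re (-k * θ)
    push_cast at e1 e2
    rw [e1, e2, neg_mul, Real.cos_neg]
    ring
  · simp [hcoeff]
    change _ = (((((1 + Real.cos θ) / 2) ^ α : ℝ) : ℂ)).re
    rw [Complex.ofReal_re]

theorem abs_rpow_sub_sum_cosRpowCoeff_le {α : ℝ} (hα : 0 < α) (h : ∀ n : ℤ, α ≠ n) {m : ℕ}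
    (hm : α < m) (θ : ℝ) :
    |((1 + Real.cos θ) / 2) ^ α - (cosRpowCoeff α 0 +
        ∑ k ∈ Finset.Icc 1 m, 2 * cosRpowCoeff α k * Real.cos (k * θ))| ≤
      Real.Gamma (α + 1 / 2) * Real.Gamma α /
        (Real.pi ^ (3 / 2 : ℝ) * (m - α) ^ (2 * α)) := by
  have hs := hasSum_cosRpowCoeff_mul_cos hα h θ
  rw [← hasSum_nat_add_iff' (m + 1), Finset.sum_range_succ'] at hs
  have hIcc : ∑ k ∈ Finset.Icc 1 m, 2 * cosRpowCoeff α k * Real.cos (k * θ) =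
      ∑ k ∈ Finset.range m, 2 * cosRpowCoeff α ((k + 1 : ℕ) : ℤ) * Real.cos ((k + 1 : ℕ) * θ) := by
    rw [Finset.range_eq_Ico, Finset.sum_Ico_add' (fun k : ℕ =>
      2 * cosRpowCoeff α (k : ℤ) * Real.cos (k * θ)) 0 m 1]
    rfl
  have hbound (N : ℕ) : ∑ k ∈ Finset.range N, |cosRpowCoeff α ((k + (m + 1) : ℕ) : ℤ)| ≤
      Real.Gamma (α + 1 / 2) * Real.Gamma (α + 1) /
        (Real.pi ^ (3 / 2 : ℝ) * (m - α) ^ (2 * α)) / (2 * α) := by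
    rw [le_div_iff₀ (by positivity)]
    refine le_trans ?_ (mul_abs_cosRpowCoeff_le hα h hm)
    rw [← two_mul_sum_abs_cosRpowCoeff hα h (M := m + 1) (by push_cast; linarith) N]
    have : 0 ≤ (α + (N + (m + 1) : ℕ)) * |cosRpowCoeff α ((N + (m + 1) : ℕ) : ℤ)| := by positivity
    linarith
  have htail := (tsum_of_norm_bounded (f := fun k : ℕ => 2 * cosRpowCoeff α ((k + (m + 1) : ℕ) : ℤ) *
    Real.cos ((k + (m + 1) : ℕ) * θ)) ((summable_of_sum_range_le (fun _ => abs_nonneg _)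
      hbound).hasSum.mul_left 2) fun k => by
        rw [Real.norm_eq_abs, abs_mul, abs_mul, abs_of_pos (two_pos : (0 : ℝ) < 2)]
        exact mul_le_of_le_one_right (by positivity) (Real.abs_cos_le_one _))
  rw [hs.tsum_eq, Real.norm_eq_abs] at htail
  rw [hIcc]
  refine le_trans (le_of_eq ?_) (htail.trans ?_)
  · congr 1
    push_cast
    simp
    ring
  · refine (mul_le_mul_of_nonneg_left (Real.tsum_le_of_sum_range_le (fun _ => abs_nonneg _) hbound)
      zero_le_two).trans (le_of_eq ?_)
    rw [Real.Gamma_add_one hα.ne']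
    field_simp

theorem one_sub_two_mul_rpow_neg_half_le {x : ℝ} (hx : |x| ≤ 1 / 4) :
    (1 - 2 * x) ^ (-(1 / 2) : ℝ) ≤ Real.exp (x + 4 * x ^ 2) := by
  obtain ⟨h1, h2⟩ := abs_le.1 hx
  have h0 : 0 < 1 - 2 * x := by linarith
  rw [Real.rpow_def_of_pos h0, Real.exp_le_exp]
  have key : -Real.log (1 - 2 * x) ≤ 2 * x + 8 * x ^ 2 := by
    rw [← Real.log_inv, Real.log_le_iff_le_exp (by positivity)]
    refine le_trans ?_ (Real.add_one_le_exp _)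
    rw [inv_le_iff_one_le_mul₀ h0]
    nlinarith [mul_nonneg (sq_nonneg x) (show 0 ≤ 1 - 4 * x by linarith)]
  linarith

theorem integrable_exp_mul_sq_gaussianReal {x : ℝ} (hx : x < 1 / 2) :
    Integrable (fun z : ℝ => Real.exp (x * z ^ 2)) (gaussianReal 0 1) := by
  rw [gaussianReal_of_var_ne_zero _ one_ne_zero, gaussianPDF_def,
    integrable_withDensity_iff_integrable_smul' (by fun_prop) (by simp)]
  refine ((integrable_exp_neg_mul_sq (b := 1 / 2 - x) (by linarith)).const_mul
    (√(2 * Real.pi))⁻¹).congr (Filter.Eventually.of_forall fun z => ?_)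
  beta_reduce
  rw [ENNReal.toReal_ofReal (gaussianPDFReal_nonneg _ _ _)]
  simp only [gaussianPDFReal, smul_eq_mul, NNReal.coe_one, mul_one, sub_zero]
  rw [mul_assoc, ← Real.exp_add]
  ring_nf

theorem integral_exp_mul_sq_gaussianReal {x : ℝ} (hx : x < 1 / 2) :
    ∫ z, Real.exp (x * z ^ 2) ∂(gaussianReal 0 1) = (1 - 2 * x) ^ (-(1 / 2) : ℝ) := by
  rw [integral_gaussianReal_eq_integral_smul one_ne_zero]
  have h0 : 0 < 1 - 2 * x := by linarith
  have h : ∀ z : ℝ, gaussianPDFReal 0 1 z • Real.exp (x * z ^ 2) =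
      (√(2 * Real.pi))⁻¹ * Real.exp (-(1 / 2 - x) * z ^ 2) := fun z => by
    simp only [gaussianPDFReal, smul_eq_mul, NNReal.coe_one, mul_one, sub_zero]
    rw [mul_assoc, ← Real.exp_add]
    ring_nf
  simp_rw [h]
  rw [integral_const_mul, integral_gaussian, ← Real.sqrt_inv, ← Real.sqrt_mul (by positivity),
    Real.rpow_neg h0.le, ← Real.sqrt_eq_rpow, ← Real.sqrt_inv]
  congr 1
  have := Real.pi_pos
  have : 1 / 2 - x ≠ 0 := by linarith
  field_simp

theorem gaussianVecs_real_le_sum_mul_sq {s n : ℕ} (a : Fin n → ℝ) {t : ℝ} (ht : 0 ≤ t)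
    (ha : ∀ i, t * |a i| ≤ 1 / 4) (c : ℝ) :
    (gaussianVecs s n).real {h | c ≤ ∑ j, ∑ i, a i * h j i ^ 2} ≤
      Real.exp (-t * c + s * (t * ∑ i, a i + 4 * t ^ 2 * ∑ i, a i ^ 2)) := by
  have : IsProbabilityMeasure (gaussianVecs s n) := by unfold gaussianVecs; infer_instance
  have ha' (i : Fin n) : |t * a i| ≤ 1 / 4 := by rw [abs_mul, abs_of_nonneg ht]; exact ha i
  have hlt (i : Fin n) : t * a i < 1 / 2 := by linarith [(abs_le.1 (ha' i)).2]
  have hexp (h : Fin s → Fin n → ℝ) : Real.exp (t * ∑ j, ∑ i, a i * h j i ^ 2) =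
      ∏ j, ∏ i, Real.exp (t * a i * h j i ^ 2) := by
    simp_rw [← Real.exp_sum, Finset.mul_sum, mul_assoc]
  have hint : Integrable (fun h : Fin s → Fin n → ℝ => Real.exp (t * ∑ j, ∑ i, a i * h j i ^ 2))
      (gaussianVecs s n) := by
    simp_rw [hexp]
    exact Integrable.fintype_prod fun _ => Integrable.fintype_prod fun i =>
      integrable_exp_mul_sq_gaussianReal (hlt i)
  refine (measure_ge_le_exp_mul_mgf c ht hint).trans ?_
  rw [Real.exp_add]
  refine mul_le_mul_of_nonneg_left ?_ (Real.exp_nonneg _)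
  simp only [mgf, hexp, gaussianVecs]
  rw [integral_fintype_prod_eq_prod (fun _ : Fin s => fun v : Fin n → ℝ =>
    ∏ i, Real.exp (t * a i * v i ^ 2)), Finset.prod_const, Finset.card_univ, Fintype.card_fin,
    integral_fintype_prod_eq_prod (fun i : Fin n => fun z : ℝ => Real.exp (t * a i * z ^ 2)),
    Real.exp_nat_mul]
  refine pow_le_pow_left₀ (Finset.prod_nonneg fun i _ => integral_nonneg fun _ =>
    Real.exp_nonneg _) ?_ s
  rw [Finset.mul_sum, Finset.mul_sum, ← Finset.sum_add_distrib, Real.exp_sum]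
  refine Finset.prod_le_prod (fun i _ => integral_nonneg fun _ => Real.exp_nonneg _) fun i _ => ?_
  rw [integral_exp_mul_sq_gaussianReal (hlt i)]
  refine (one_sub_two_mul_rpow_neg_half_le (ha' i)).trans_eq ?_
  congr 1
  ring

theorem measurePreserving_pi_gaussianReal_mulVec {n : ℕ} {A : Matrix (Fin n) (Fin n) ℝ}
    (hA : A.IsHermitian) :
    MeasurePreserving (fun x : Fin n → ℝ => (hA.eigenvectorUnitary : Matrix (Fin n) (Fin n) ℝ).mulVec x)
      (Measure.pi fun _ => gaussianReal 0 1) (Measure.pi fun _ => gaussianReal 0 1) := by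
  have h1 := stdGaussian_eq_map_pi_orthonormalBasis hA.eigenvectorBasis
  rw [← map_pi_eq_stdGaussian] at h1
  have h2 := congrArg (Measure.map (WithLp.ofLp (p := 2) (V := Fin n → ℝ))) h1
  rw [Measure.map_map (by fun_prop) (by fun_prop), Measure.map_map (by fun_prop) (by fun_prop)] at h2
  refine ⟨by fun_prop, ?_⟩
  convert h2.symm using 1
  · congr 1
    ext x i
    simp [Matrix.mulVec, dotProduct, Matrix.IsHermitian.eigenvectorUnitary_apply, mul_comm]
  · exact Measure.map_id.symm

theorem chebApproxMatrix_eq_mul_diagonal_mul {n : ℕ} {G : Matrix (Fin n) (Fin n) ℝ}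
    (hG : G.IsHermitian) (α lmax : ℝ) (m : ℕ) :
    chebApproxMatrix α lmax m G = (hG.eigenvectorUnitary : Matrix (Fin n) (Fin n) ℝ) *
      diagonal (fun i => chebCoeff α lmax 0 / 2 + ∑ k ∈ Finset.Icc 1 m, chebCoeff α lmax k *
        (Polynomial.Chebyshev.T ℝ (k : ℤ)).eval (2 / lmax * hG.eigenvalues i - 1)) *
      (star hG.eigenvectorUnitary : Matrix (Fin n) (Fin n) ℝ) := by
  let ψ : (Fin n → ℝ) →ₐ[ℝ] Matrix (Fin n) (Fin n) ℝ :=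
    ((Unitary.conjStarAlgAut ℝ _ hG.eigenvectorUnitary : _ ≃⋆ₐ[ℝ] _) :
      Matrix (Fin n) (Fin n) ℝ →ₐ[ℝ] Matrix (Fin n) (Fin n) ℝ).comp (diagonalAlgHom ℝ)
  have hψ (v : Fin n → ℝ) : ψ v = (hG.eigenvectorUnitary : Matrix (Fin n) (Fin n) ℝ) * diagonal v *
      (star hG.eigenvectorUnitary : Matrix (Fin n) (Fin n) ℝ) := rfl
  have hGψ : G = ψ hG.eigenvalues := hG.spectral_theorem
  have hc : chebApproxMatrix α lmax m G = ψ ((chebCoeff α lmax 0 / 2) • 1 +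
      ∑ k ∈ Finset.Icc 1 m, chebCoeff α lmax k •
        Polynomial.aeval ((2 / lmax) • hG.eigenvalues - 1)
          (Polynomial.Chebyshev.T ℝ (k : ℤ))) := by
    simp only [map_add, map_smul, map_one, map_sum, ← Polynomial.aeval_algHom_apply, map_sub,
      ← hGψ, chebApproxMatrix]
  rw [hc, hψ]
  congr 3
  ext i
  simp only [Pi.add_apply, Pi.smul_apply, Pi.one_apply, smul_eq_mul, mul_one, Finset.sum_apply]
  congr 1
  refine Finset.sum_congr rfl fun k _ => ?_
  congr 1
  have := Polynomial.aeval_algHom_apply (Pi.evalAlgHom ℝ (fun _ : Fin n => ℝ) i)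
    ((2 / lmax) • hG.eigenvalues - 1) (Polynomial.Chebyshev.T ℝ (k : ℤ))
  rw [← Polynomial.coe_aeval_eq_eval]
  exact this.symm

theorem mulVec_dotProduct_mul_diagonal_mul_mulVec {n : ℕ} (U : unitary (Matrix (Fin n) (Fin n) ℝ))
    (a x : Fin n → ℝ) :
    ((U : Matrix (Fin n) (Fin n) ℝ).mulVec x) ⬝ᵥ ((U : Matrix (Fin n) (Fin n) ℝ) * diagonal a *
      (star U : Matrix (Fin n) (Fin n) ℝ)).mulVec ((U : Matrix (Fin n) (Fin n) ℝ).mulVec x) = ∑ i, a i * x i ^ 2 := by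
  have hU : (star U : Matrix (Fin n) (Fin n) ℝ) * (U : Matrix (Fin n) (Fin n) ℝ) = 1 := Unitary.coe_star_mul_self U
  have hU' : (U : Matrix (Fin n) (Fin n) ℝ)ᵀ * (U : Matrix (Fin n) (Fin n) ℝ) = 1 := by
    rw [← hU, star_eq_conjTranspose, conjTranspose_eq_transpose_of_trivial]
  rw [mulVec_mulVec, mul_assoc, mul_assoc, hU, mul_one, ← mulVec_mulVec, dotProduct_mulVec,
    ← vecMul_transpose, vecMul_vecMul, hU', vecMul_one]
  simp only [dotProduct, mulVec_diagonal]
  exact Finset.sum_congr rfl fun i _ => by ring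

theorem abs_rpow_sub_chebCoeff_sum_le {α lmax x : ℝ} (hα : 0 < α) (h : ∀ n : ℤ, α ≠ n) {m : ℕ}
    (hm : α < m) (hl : 0 < lmax) (hx0 : 0 ≤ x) (hx : x ≤ lmax) :
    |x ^ α - (chebCoeff α lmax 0 / 2 + ∑ k ∈ Finset.Icc 1 m, chebCoeff α lmax k *
        (Polynomial.Chebyshev.T ℝ (k : ℤ)).eval (2 / lmax * x - 1))| ≤
      lmax ^ α * (Real.Gamma (α + 1 / 2) * Real.Gamma α /
        (Real.pi ^ (3 / 2 : ℝ) * (m - α) ^ (2 * α))) := by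
  have hb := abs_rpow_sub_sum_cosRpowCoeff_le hα h hm (Real.arccos (2 / lmax * x - 1))
  have hle : x / lmax ≤ 1 := (div_le_one hl).2 hx
  have hnn : 0 ≤ x / lmax := by positivity
  have hcos : Real.cos (Real.arccos (2 / lmax * x - 1)) = 2 / lmax * x - 1 := by
    have : 2 / lmax * x = 2 * (x / lmax) := by ring
    exact Real.cos_arccos (by linarith) (by linarith)
  have hcoeff (k : ℕ) : chebCoeff α lmax k = lmax ^ α * (2 * cosRpowCoeff α k) := by
    simp only [chebCoeff, cosRpowCoeff, Int.cast_natCast]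
    ring
  have hxα : x ^ α = lmax ^ α * ((1 + (2 / lmax * x - 1)) / 2) ^ α := by
    rw [← Real.mul_rpow hl.le (by rw [show (1 + (2 / lmax * x - 1)) / 2 = x / lmax by ring]; exact hnn)]
    congr 1
    field_simp
    ring
  have hT (k : ℕ) : (Polynomial.Chebyshev.T ℝ (k : ℤ)).eval (2 / lmax * x - 1) =
      Real.cos (k * Real.arccos (2 / lmax * x - 1)) := by
    simpa [hcos] using
      Polynomial.Chebyshev.T_real_cos (Real.arccos (2 / lmax * x - 1)) k
  have hlα : 0 < lmax ^ α := by positivity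
  simp_rw [hT]
  rw [hcos] at hb
  rw [hxα]
  simp only [hcoeff]
  refine le_trans (le_of_eq ?_) (mul_le_mul_of_nonneg_left hb hlα.le)
  rw [← abs_of_pos hlα, ← abs_mul, abs_of_pos hlα]
  congr 1
  rw [mul_sub, mul_add, Finset.mul_sum]
  simp only [mul_assoc, Nat.cast_zero]
  ring

theorem abs_logb_sub_logb_le {T H x : ℝ} (hT : 0 < T) (hx0 : 0 ≤ x) (hx1 : x < 1)
    (hl : (1 - x) * T < H) (hu : H < (1 + x) * T) (r : ℝ) :
    |r * Real.logb 2 T - r * Real.logb 2 H| ≤ |r * Real.logb 2 (1 - x)| := by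
  have hx : 0 < 1 - x := by linarith
  have hH : 0 < H := (mul_pos hx hT).trans hl
  have h1 := (Real.log_lt_log (by positivity) hl).le
  have h2 : Real.log H ≤ Real.log (T / (1 - x)) := by
    refine Real.log_le_log hH ?_
    rw [le_div_iff₀ hx]
    nlinarith [mul_nonneg hT.le (sq_nonneg x)]
  rw [Real.log_mul hx.ne' hT.ne'] at h1
  rw [Real.log_div hT.ne' hx.ne'] at h2
  rw [← mul_sub, abs_mul, abs_mul]
  refine mul_le_mul_of_nonneg_left ?_ (abs_nonneg r)
  simp only [Real.logb]
  rw [← sub_div, abs_div, abs_div]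
  refine div_le_div_of_nonneg_right ?_ (abs_nonneg _)
  rw [abs_le, abs_of_nonpos (Real.log_nonpos hx.le (by linarith))]
  constructor <;> linarith

theorem gaussianVecs_real_deviation_le {s n : ℕ} (a : Fin n → ℝ) {T c ε δ : ℝ} (hT : 0 < T)
    (hε0 : 0 < ε) (hε1 : ε < 1 / 3) (hδ : 0 < δ) (ha : ∑ i, |a i| ≤ (1 + ε) * T)
    (haT : ∑ i, a i ≤ c + ε * T) (hs : 8 * Real.log (2 / δ) / ε ^ 2 ≤ s) :
    (gaussianVecs s n).real {h | s * (c + 3 * ε * T) ≤ ∑ j, ∑ i, a i * h j i ^ 2} ≤ δ / 2 := by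
  have hle (i : Fin n) : |a i| ≤ (1 + ε) * T :=
    (Finset.single_le_sum (fun j _ => abs_nonneg (a j)) (Finset.mem_univ i)).trans ha
  have hsq : ∑ i, a i ^ 2 ≤ ((1 + ε) * T) ^ 2 := by
    calc ∑ i, a i ^ 2 ≤ ∑ i, |a i| * ((1 + ε) * T) := Finset.sum_le_sum fun i _ => by
          rw [← sq_abs, sq]
          exact mul_le_mul_of_nonneg_left (hle i) (abs_nonneg _)
      _ ≤ _ := by
          rw [← Finset.sum_mul, sq]
          exact mul_le_mul_of_nonneg_right ha (by positivity)
  set t : ℝ := ε / (8 * T) with ht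
  have htT : t * T = ε / 8 := by rw [ht]; field_simp
  have ht0 : 0 < t := by positivity
  refine (gaussianVecs_real_le_sum_mul_sq a ht0.le (fun i => ?_) _).trans ?_
  · calc t * |a i| ≤ t * ((1 + ε) * T) := mul_le_mul_of_nonneg_left (hle i) ht0.le
      _ = (1 + ε) * (t * T) := by ring
      _ ≤ 1 / 4 := by rw [htT]; nlinarith
  · rw [← Real.le_log_iff_exp_le (by positivity)]
    have hlog : Real.log (δ / 2) = -Real.log (2 / δ) := by rw [← Real.log_inv, inv_div]
    rw [hlog]
    rw [div_le_iff₀ (by positivity)] at hs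
    have h1 : t * ∑ i, a i ≤ t * c + ε * (ε / 8) := by
      rw [← htT]; nlinarith [mul_le_mul_of_nonneg_left haT ht0.le]
    have h2 : 4 * t ^ 2 * ∑ i, a i ^ 2 ≤ ε ^ 2 / 9 := by
      calc 4 * t ^ 2 * ∑ i, a i ^ 2 ≤ 4 * t ^ 2 * ((1 + ε) * T) ^ 2 := by gcongr
        _ = 4 * (1 + ε) ^ 2 * (t * T) ^ 2 := by ring
        _ ≤ 4 * (4 / 3) ^ 2 * (ε / 8) ^ 2 := by rw [htT]; gcongr; linarith
        _ = _ := by ring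
    have h3 : t * ∑ i, a i + 4 * t ^ 2 * ∑ i, a i ^ 2 - t * (c + 3 * ε * T) ≤ -(ε ^ 2 / 8) := by
      have : t * (c + 3 * ε * T) = t * c + 3 * ε * (ε / 8) := by rw [← htT]; ring
      rw [this]
      nlinarith [sq_nonneg ε]
    have h4 := mul_le_mul_of_nonneg_left h3 (Nat.cast_nonneg s : (0 : ℝ) ≤ s)
    nlinarith

/-- Chebyshev estimator for fractional-order matrix-based Rényi entropy,
possibly rank-deficient case, with `m ≥ α + (n·Γ(α+1/2)·Γ(α)/(ε·π^{3/2}))^{1/(2α)}`. -/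
theorem stmt11 {n : ℕ} (G : Matrix (Fin n) (Fin n) ℝ)
    (hG : G.PosSemidef) (hG0 : G ≠ 0)
    (lmax : ℝ) (hlmax : lmax = ⨆ i, hG.isHermitian.eigenvalues i)
    (α : ℝ) (hα : 0 < α) (hαni : ∀ k : ℕ, α ≠ k) (hα1 : α ≠ 1)
    (ε δ : ℝ) (hε : ε ∈ Set.Ioo (0 : ℝ) (1 / 3)) (hδ : δ ∈ Set.Ioo (0 : ℝ) 1)
    (s : ℕ) (hs : s = ⌈8 * Real.log (2 / δ) / ε ^ 2⌉₊)
    (m : ℕ)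
    (hm : α + ((n : ℝ) * Real.Gamma (α + 1 / 2) * Real.Gamma α /
        (ε * Real.pi ^ ((3 : ℝ) / 2))) ^ (1 / (2 * α)) ≤ (m : ℝ)) :
    1 - ENNReal.ofReal δ ≤
      gaussianVecs s n
        {g | |(1 / (1 - α)) * Real.logb 2 (∑ i, hG.isHermitian.eigenvalues i ^ α)
              - (1 / (1 - α)) * Real.logb 2
                  ((1 / (s : ℝ)) * ∑ i, g i ⬝ᵥ (chebApproxMatrix α lmax m G).mulVec (g i))|
            ≤ |(1 / (1 - α)) * Real.logb 2 (1 - 3 * ε)|} := by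
  obtain ⟨hε0, hε1⟩ := hε
  obtain ⟨hδ0, hδ1⟩ := hδ
  have hαz := ne_intCast_of_forall_ne_natCast hα hαni
  set ev := hG.isHermitian.eigenvalues with hev
  have hev0 (i : Fin n) : 0 ≤ ev i := hG.eigenvalues_nonneg i
  obtain ⟨i₀, hi₀⟩ : ∃ i, ev i ≠ 0 := by
    by_contra! h0
    exact hG0 (hG.isHermitian.eigenvalues_eq_zero_iff.1 (funext h0))
  have hn : 0 < n := i₀.pos
  have : Nonempty (Fin n) := ⟨i₀⟩
  have hle (i : Fin n) : ev i ≤ lmax := hlmax ▸ le_ciSup (Set.finite_range ev).bddAbove i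
  have hl : 0 < lmax := ((hev0 i₀).lt_of_ne' hi₀).trans_le (hle i₀)
  set T := ∑ i, ev i ^ α with hTdef
  have hlT : lmax ^ α ≤ T := by
    obtain ⟨i, hi⟩ := exists_eq_ciSup_of_finite (f := ev)
    rw [hlmax, ← hi]
    exact Finset.single_le_sum (f := fun i => ev i ^ α)
      (fun j _ => Real.rpow_nonneg (hev0 j) _) (Finset.mem_univ i)
  have hlα : 0 < lmax ^ α := by positivity
  have hT : 0 < T := hlα.trans_le hlT
  have hGh := Real.Gamma_pos_of_pos (show 0 < α + 1 / 2 by linarith)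
  have hGa := Real.Gamma_pos_of_pos hα
  set b := (n : ℝ) * Real.Gamma (α + 1 / 2) * Real.Gamma α / (ε * Real.pi ^ ((3 : ℝ) / 2)) with hb
  have hb0 : 0 < b := by positivity
  have hmα : b ^ (1 / (2 * α)) ≤ m - α := by linarith
  have hαm : α < m := by linarith [Real.rpow_pos_of_pos hb0 (1 / (2 * α))]
  have hbm : b ≤ (m - α) ^ (2 * α) := by
    have h1 := Real.rpow_le_rpow (by positivity) hmα (show 0 ≤ 2 * α by positivity)
    rwa [← Real.rpow_mul hb0.le, one_div_mul_cancel (by positivity), Real.rpow_one] at h1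
  set a : Fin n → ℝ := fun i => chebCoeff α lmax 0 / 2 + ∑ k ∈ Finset.Icc 1 m,
    chebCoeff α lmax k * (Polynomial.Chebyshev.T ℝ (k : ℤ)).eval (2 / lmax * ev i - 1) with ha
  have herr : ∑ i, |ev i ^ α - a i| ≤ ε * T := by
    refine (Finset.sum_le_sum fun i _ => abs_rpow_sub_chebCoeff_sum_le hα hαz hαm hl (hev0 i)
      (hle i)).trans ?_
    rw [Finset.sum_const, Finset.card_univ, Fintype.card_fin, nsmul_eq_mul, mul_left_comm,
      mul_comm ε]
    refine mul_le_mul hlT ?_ (by have := sub_pos.2 hαm; positivity) hT.le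
    rw [hb, div_le_iff₀ (by positivity)] at hbm
    have := sub_pos.2 hαm
    rw [← mul_div_assoc, div_le_iff₀ (by positivity)]
    linarith
  have habs : ∑ i, |a i| ≤ (1 + ε) * T := by
    have : ∑ i, |a i| ≤ ∑ i, (ev i ^ α + |ev i ^ α - a i|) := Finset.sum_le_sum fun i _ => by
      have h1 := abs_sub_abs_le_abs_sub (a i) (ev i ^ α)
      rw [abs_of_nonneg (Real.rpow_nonneg (hev0 i) _), abs_sub_comm] at h1
      linarith
    rw [Finset.sum_add_distrib] at this
    linarith
  have hsum : |T - ∑ i, a i| ≤ ε * T := by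
    rw [hTdef, ← Finset.sum_sub_distrib]
    exact (Finset.abs_sum_le_sum_abs _ _).trans herr
  obtain ⟨hsum1, hsum2⟩ := abs_le.1 hsum
  have hs8 : 8 * Real.log (2 / δ) / ε ^ 2 ≤ s := hs ▸ Nat.le_ceil _
  have hs0 : 0 < (s : ℝ) := by
    have : 0 < Real.log (2 / δ) := Real.log_pos (by rw [lt_div_iff₀ hδ0]; linarith)
    exact lt_of_lt_of_le (by positivity) hs8
  have hP : IsProbabilityMeasure (gaussianVecs s n) := by unfold gaussianVecs; infer_instance
  have hmp : MeasurePreserving (fun (h : Fin s → Fin n → ℝ) j =>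
      (hG.isHermitian.eigenvectorUnitary : Matrix (Fin n) (Fin n) ℝ).mulVec (h j))
      (gaussianVecs s n) (gaussianVecs s n) :=
    measurePreserving_pi _ _ fun _ => measurePreserving_pi_gaussianReal_mulVec hG.isHermitian
  have hup := gaussianVecs_real_deviation_le (s := s) (c := T) a hT hε0 hε1 hδ0 habs
    (by linarith) hs8
  have hlo := gaussianVecs_real_deviation_le (s := s) (c := -T) (fun i => -a i) hT hε0 hε1 hδ0
    (by simpa only [abs_neg] using habs) (by rw [Finset.sum_neg_distrib]; linarith) hs8
  set B₁ := {h : Fin s → Fin n → ℝ | s * (T + 3 * ε * T) ≤ ∑ j, ∑ i, a i * h j i ^ 2} with hB₁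
  set B₂ := {h : Fin s → Fin n → ℝ | s * (-T + 3 * ε * T) ≤ ∑ j, ∑ i, -a i * h j i ^ 2} with hB₂
  have hmeas : MeasurableSet (B₁ ∪ B₂) :=
    (measurableSet_le measurable_const (by fun_prop)).union
      (measurableSet_le measurable_const (by fun_prop))
  have hB : gaussianVecs s n (B₁ ∪ B₂) ≤ ENNReal.ofReal δ := by
    rw [← ofReal_measureReal]
    exact ENNReal.ofReal_le_ofReal ((measureReal_union_le _ _).trans (by linarith))
  calc 1 - ENNReal.ofReal δ ≤ gaussianVecs s n (B₁ ∪ B₂)ᶜ := by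
        rw [prob_compl_eq_one_sub hmeas]
        exact tsub_le_tsub_left hB 1
    _ ≤ gaussianVecs s n (_ ⁻¹' _) := measure_mono fun h hh => ?_
    _ ≤ (gaussianVecs s n).map _ _ := Measure.le_map_apply hmp.measurable.aemeasurable _
    _ = _ := by rw [hmp.map_eq]
  simp only [Set.mem_compl_iff, Set.mem_union, not_or, hB₁, hB₂, Set.mem_ofPred_eq, not_le,
    neg_mul, Finset.sum_neg_distrib] at hh
  obtain ⟨hh1, hh2⟩ := hh
  simp only [Set.mem_preimage, Set.mem_ofPred_eq,
    chebApproxMatrix_eq_mul_diagonal_mul hG.isHermitian, mulVec_dotProduct_mul_diagonal_mul_mulVec]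
  refine abs_logb_sub_logb_le hT (by linarith) (by linarith) ?_ ?_ _
  · rw [one_div, inv_mul_eq_div, lt_div_iff₀ hs0]
    change _ < ∑ j, ∑ i, a i * h j i ^ 2
    linarith
  · rw [one_div, inv_mul_eq_div, div_lt_iff₀ hs0]
    change ∑ j, ∑ i, a i * h j i ^ 2 < _
    linarith
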